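/- Suppose there exist a finite integer N ≥ 1, distinct points X_1, ..., X_N in ℝ³ with 0 < |X_k| < 1 for every k, and nonzero real numbers m_1, ..., m_N with Σ_{k=1}^{N} m_k = 0, such that Σ_{k=1}^{N} m_k / |X − X_k| = 0 for every X ∈ ℝ³ with |X| ≥ 1. Then there exist distinct points Y_1, ..., Y_N in ℝ² with 0 < |Y_k| < 1 for every k (obtained by orthogonally projecting the X_k, after a suitable rotation of coordinates, onto ℝ²), such that Σ_{k=1}^{N} m_k ln(|Y| / |Y − Y_k|) = 0 for every Y ∈ ℝ² with |Y| ≥ 1, with the same nonzero coefficients m_k. -/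

import Mathlib

/-- If a point-mass uniqueness counterexample exists in `ℝ³` (nonzero masses summing to
zero at distinct points of the punctured open unit ball whose potential vanishes on
`‖X‖ ≥ 1`), then one exists in `ℝ²` with the same nonzero masses. -/
theorem point_mass_counterexample_R3_to_R2 (N : ℕ) (hN : 1 ≤ N)
    (X : Fin N → EuclideanSpace ℝ (Fin 3)) (hX : Function.Injective X)
    (hX1 : ∀ k, 0 < ‖X k‖ ∧ ‖X k‖ < 1)
    (m : Fin N → ℝ) (hm : ∀ k, m k ≠ 0) (hsum : ∑ k, m k = 0)
    (h : ∀ P : EuclideanSpace ℝ (Fin 3), 1 ≤ ‖P‖ → ∑ k, m k / ‖P - X k‖ = 0) :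
    ∃ Y : Fin N → EuclideanSpace ℝ (Fin 2), Function.Injective Y ∧
      (∀ k, 0 < ‖Y k‖ ∧ ‖Y k‖ < 1) ∧
      ∀ Q : EuclideanSpace ℝ (Fin 2), 1 ≤ ‖Q‖ →
        ∑ k, m k * Real.log (‖Q‖ / ‖Q - Y k‖) = 0 := by
  exfalso
  have k0 : Fin N := ⟨0, hN⟩
  let f : EuclideanSpace ℝ (Fin 3) → ℝ := fun P => ∑ k, m k / ‖P - X k‖
  have hfin : (Set.range X).Finite := Set.finite_range X
  have hconn : IsPreconnected (Set.range X)ᶜ := by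
    refine (Set.Countable.isPathConnected_compl_of_one_lt_rank ?_
      hfin.countable).isConnected.isPreconnected
    rw [← Module.finrank_eq_rank, finrank_euclideanSpace_fin]
    norm_num
  have han : AnalyticOnNhd ℝ f (Set.range X)ᶜ := by
    intro P hP
    apply ContDiffAt.analyticAt
    apply ContDiffAt.sum
    intro k _
    have hne : P - X k ≠ 0 := fun h0 => hP ⟨k, (sub_eq_zero.mp h0).symm⟩
    exact contDiffAt_const.div ((contDiffAt_id.sub contDiffAt_const).norm ℝ hne)
      (norm_ne_zero_iff.mpr hne)
  let P0 : EuclideanSpace ℝ (Fin 3) := EuclideanSpace.single 0 2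
  have hP0n : ‖P0‖ = 2 := by simp [P0]
  have hP0 : P0 ∈ (Set.range X)ᶜ := by
    rintro ⟨k, hk⟩
    have := (hX1 k).2
    rw [hk, hP0n] at this
    norm_num at this
  have hev : f =ᶠ[nhds P0] 0 := by
    have : ∀ᶠ P in nhds P0, 1 < ‖P‖ :=
      continuous_norm.continuousAt.eventually (lt_mem_nhds (by change 1 < ‖P0‖; rw [hP0n]; norm_num))
    filter_upwards [this] with P hP using h P hP.le
  have hzero := han.eqOn_zero_of_preconnected_of_eventuallyEq_zero hconn hP0 hev
  -- blow up at `X k0`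
  have hlim : Filter.Tendsto (fun P => ∑ k, m k * (‖P - X k0‖ / ‖P - X k‖))
      (nhdsWithin (X k0) {X k0}ᶜ) (nhds (∑ k, if k = k0 then m k else 0)) := by
    apply tendsto_finsetSum
    intro k _
    by_cases hk : k = k0
    · subst hk
      rw [if_pos rfl]
      refine tendsto_const_nhds.congr' ?_
      filter_upwards [self_mem_nhdsWithin] with P hP
      rw [div_self (norm_ne_zero_iff.mpr (sub_ne_zero.mpr hP)), mul_one]
    · rw [if_neg hk]
      have hne : ‖X k0 - X k‖ ≠ 0 :=
        norm_ne_zero_iff.mpr (sub_ne_zero.mpr fun e => hk (hX e).symm)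
      have hc : ContinuousAt (fun P => m k * (‖P - X k0‖ / ‖P - X k‖)) (X k0) :=
        continuousAt_const.mul (ContinuousAt.div (by fun_prop) (by fun_prop) hne)
      have := hc.tendsto
      simp only [sub_self, norm_zero, zero_div, mul_zero] at this
      exact this.mono_left nhdsWithin_le_nhds
  rw [Finset.sum_ite_eq' Finset.univ k0 m, if_pos (Finset.mem_univ _)] at hlim
  have hev0 : ∀ᶠ P in nhdsWithin (X k0) {X k0}ᶜ, P ∈ (Set.range X)ᶜ := by
    have h1 : (Set.range X \ {X k0})ᶜ ∈ nhds (X k0) :=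
      (hfin.subset Set.sdiff_subset).isClosed.isOpen_compl.mem_nhds (by simp)
    filter_upwards [self_mem_nhdsWithin, nhdsWithin_le_nhds h1] with P hP hP1 hP2
    exact hP1 ⟨hP2, hP⟩
  have hlim0 : Filter.Tendsto (fun P => ∑ k, m k * (‖P - X k0‖ / ‖P - X k‖))
      (nhdsWithin (X k0) {X k0}ᶜ) (nhds 0) := by
    refine tendsto_const_nhds.congr' ?_
    filter_upwards [hev0] with P hP
    have h2 : ∑ k, m k / ‖P - X k‖ = 0 := hzero hP
    calc (0 : ℝ) = ‖P - X k0‖ * ∑ k, m k / ‖P - X k‖ := by rw [h2, mul_zero]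
      _ = _ := by
        rw [Finset.mul_sum]
        exact Finset.sum_congr rfl fun k _ => by ring
  have : (nhdsWithin (X k0) {X k0}ᶜ).NeBot := Module.punctured_nhds_neBot ℝ _ _
  exact hm k0 (tendsto_nhds_unique hlim hlim0)
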